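/- Let G = (N, v) be a characteristic function game with |N| = n ≥ 2. Then the Exchange Value of agent i equals the average, over group sizes m = 1,…,n−1, of the difference between the average value of size-m groups containing i and the average value of size-m groups not containing i: EV_i(G) = (1/(n−1)) Σ_{m=1}^{n−1} [ (binom(n−1, m−1))^{−1} Σ_{C ⊆ N, |C| = m, i ∈ C} v(C) − (binom(n−1, m))^{−1} Σ_{C ⊆ N, |C| = m, i ∉ C} v(C) ]. -/

import Mathlib

open Finset

/-- The set of all permutations (encoded as lists) of the elements of a finset `s`.
For a nodup base list this is exactly the set `Π_s` of orderings of `s`. -/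
noncomputable def permsOf {α : Type*} [DecidableEq α] (s : Finset α) : Finset (List α) :=
  s.toList.permutations.toFinset

/-- The Shapley Value of agent `i` in the characteristic function game on the
(full, finite) agent set `α` with characteristic function `v`:
`SV_i = (1/n!) ∑_{m=0}^{n-1} ∑_{π ∈ Π_{N∖{i}}} (v (S_π(m) ∪ {i}) - v (S_π(m)))`,
where `S_π(m)` is the set of the first `m` entries of `π`. -/
noncomputable def ShapleyValue {α : Type*} [Fintype α] [DecidableEq α]
    (v : Finset α → ℝ) (i : α) : ℝ :=
  (((Fintype.card α).factorial : ℝ))⁻¹ *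
    ∑ π ∈ permsOf (Finset.univ.erase i), ∑ m ∈ Finset.range (Fintype.card α),
      (v (insert i (π.take m).toFinset) - v (π.take m).toFinset)

/-- The Exchange Value of agent `i`:
`EV_i = (1/((n-1)!·(n-1))) ∑_{m=1}^{n-1} ∑_{π ∈ Π_{N∖{i}}} (v (S_π(m-1) ∪ {i}) - v (S_π(m)))`. -/
noncomputable def ExchangeValue {α : Type*} [Fintype α] [DecidableEq α]
    (v : Finset α → ℝ) (i : α) : ℝ :=
  ((((Fintype.card α - 1).factorial * (Fintype.card α - 1) : ℕ) : ℝ))⁻¹ *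
    ∑ π ∈ permsOf (Finset.univ.erase i), ∑ m ∈ Finset.Icc 1 (Fintype.card α - 1),
      (v (insert i (π.take (m - 1)).toFinset) - v (π.take m).toFinset)

theorem mem_permsOf {α : Type*} [DecidableEq α] {s : Finset α} {l : List α} :
    l ∈ permsOf s ↔ l.Nodup ∧ l.toFinset = s := by
  rw [permsOf, List.mem_toFinset, List.mem_permutations]
  constructor
  · intro h
    exact ⟨h.nodup_iff.2 s.nodup_toList, by rw [List.toFinset_eq_of_perm _ _ h, toList_toFinset]⟩
  · rintro ⟨hl, rfl⟩
    exact (List.toFinset_toList hl).symm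

theorem card_permsOf {α : Type*} [DecidableEq α] (s : Finset α) :
    #(permsOf s) = (#s).factorial := by
  rw [permsOf, List.toFinset_card_of_nodup (List.nodup_permutations _ s.nodup_toList),
    List.length_permutations, length_toList]

theorem length_of_mem_permsOf {α : Type*} [DecidableEq α] {s : Finset α} {l : List α}
    (hl : l ∈ permsOf s) : l.length = #s := by
  obtain ⟨hnd, rfl⟩ := mem_permsOf.1 hl
  exact (List.toFinset_card_of_nodup hnd).symm

theorem append_mem_permsOf {α : Type*} [DecidableEq α] {s t : Finset α} {l l' : List α}
    (hl : l ∈ permsOf s) (hl' : l' ∈ permsOf t) (h : Disjoint s t) :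
    l ++ l' ∈ permsOf (s ∪ t) := by
  obtain ⟨hnd, rfl⟩ := mem_permsOf.1 hl
  obtain ⟨hnd', rfl⟩ := mem_permsOf.1 hl'
  exact mem_permsOf.2 ⟨hnd.append hnd' (List.disjoint_toFinset_iff_disjoint.1 h),
    List.toFinset_append⟩

theorem toFinset_take_mem_powersetCard {α : Type*} [DecidableEq α] {s : Finset α} {m : ℕ}
    (hm : m ≤ #s) {l : List α} (hl : l ∈ permsOf s) :
    (l.take m).toFinset ∈ powersetCard m s := by
  have hlen := length_of_mem_permsOf hl
  obtain ⟨hnd, rfl⟩ := mem_permsOf.1 hl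
  rw [mem_powersetCard, List.toFinset_card_of_nodup (hnd.sublist (List.take_sublist m l)),
    List.length_take]
  exact ⟨fun x hx => List.mem_toFinset.2 (List.mem_of_mem_take (List.mem_toFinset.1 hx)),
    by omega⟩

/-- The orderings of `s` whose first `m` entries form `C` are the concatenations of an ordering
of `C` with an ordering of `s \ C`. -/
theorem card_filter_permsOf_take_eq {α : Type*} [DecidableEq α] {s C : Finset α} {m : ℕ}
    (hC : C ∈ powersetCard m s) :
    #{l ∈ permsOf s | (l.take m).toFinset = C} = m.factorial * (#s - m).factorial := by
  obtain ⟨hCs, rfl⟩ := mem_powersetCard.1 hC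
  rw [← card_sdiff_of_subset hCs, ← card_permsOf C, ← card_permsOf (s \ C), ← card_product]
  refine card_nbij' (fun l => (l.take #C, l.drop #C)) (fun p => p.1 ++ p.2) ?_ ?_ ?_ ?_
  · intro l hl
    obtain ⟨hl, hlC⟩ := mem_filter.1 hl
    obtain ⟨hnd, rfl⟩ := mem_permsOf.1 hl
    have hd : (l.drop #C).toFinset = l.toFinset \ C := by
      have hdisj : Disjoint C (l.drop #C).toFinset := by
        nth_rewrite 1 [← hlC]
        exact List.disjoint_toFinset_iff_disjoint.2 (List.disjoint_take_drop hnd le_rfl)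
      have hunion : l.toFinset = C ∪ (l.drop #C).toFinset := by
        conv_lhs => rw [← List.take_append_drop #C l, List.toFinset_append, hlC]
      rw [hunion, union_sdiff_cancel_left hdisj]
    exact mem_product.2 ⟨mem_permsOf.2 ⟨hnd.sublist (List.take_sublist _ _), hlC⟩,
      mem_permsOf.2 ⟨hnd.sublist (List.drop_sublist _ _), hd⟩⟩
  · rintro ⟨l, l'⟩ h
    obtain ⟨hl, hl'⟩ := mem_product.1 h
    refine mem_filter.2 ⟨?_, ?_⟩
    · simpa only [union_sdiff_of_subset hCs] using append_mem_permsOf hl hl' disjoint_sdiff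
    · rw [List.take_left' (length_of_mem_permsOf hl)]
      exact (mem_permsOf.1 hl).2
  · intro l _
    exact List.take_append_drop _ _
  · rintro ⟨l, l'⟩ h
    have hlen := length_of_mem_permsOf (mem_product.1 h).1
    exact Prod.ext (List.take_left' hlen) (List.drop_left' hlen)

theorem sum_permsOf_take {α : Type*} [DecidableEq α] {s : Finset α} {m : ℕ} (hm : m ≤ #s)
    (f : Finset α → ℝ) :
    ∑ l ∈ permsOf s, f (l.take m).toFinset =
      (m.factorial * (#s - m).factorial : ℕ) * ∑ C ∈ powersetCard m s, f C := by
  rw [← sum_fiberwise_of_maps_to (fun l hl => toFinset_take_mem_powersetCard hm hl), mul_sum]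
  refine sum_congr rfl fun C hC => ?_
  rw [sum_congr rfl fun l hl => congrArg f (mem_filter.1 hl).2, sum_const,
    card_filter_permsOf_take_eq hC, nsmul_eq_mul]

theorem inv_factorial_mul_sum_permsOf_take {α : Type*} [DecidableEq α] {s : Finset α} {m : ℕ}
    (hm : m ≤ #s) (f : Finset α → ℝ) :
    ((#s).factorial : ℝ)⁻¹ * ∑ l ∈ permsOf s, f (l.take m).toFinset =
      ((#s).choose m : ℝ)⁻¹ * ∑ C ∈ powersetCard m s, f C := by
  rw [sum_permsOf_take hm, ← Nat.choose_mul_factorial_mul_factorial hm]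
  have h₁ := Nat.cast_ne_zero (R := ℝ) |>.2 (Nat.choose_pos hm).ne'
  have h₂ := Nat.cast_ne_zero (R := ℝ) |>.2 m.factorial_ne_zero
  have h₃ := Nat.cast_ne_zero (R := ℝ) |>.2 (#s - m).factorial_ne_zero
  push_cast
  field_simp

theorem filter_notMem_powersetCard_univ {α : Type*} [Fintype α] [DecidableEq α] (i : α) (m : ℕ) :
    {C ∈ (univ : Finset α).powersetCard m | i ∉ C} = (univ.erase i).powersetCard m := by
  ext C
  simp [mem_powersetCard, subset_erase, and_comm]

theorem sum_filter_mem_powersetCard_univ {α : Type*} [Fintype α] [DecidableEq α] (i : α) {m : ℕ}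
    (hm : 1 ≤ m) (f : Finset α → ℝ) :
    ∑ C ∈ (univ : Finset α).powersetCard m with i ∈ C, f C =
      ∑ C ∈ (univ.erase i).powersetCard (m - 1), f (insert i C) := by
  symm
  refine sum_nbij' (insert i) (erase · i) ?_ ?_ ?_ ?_ fun _ _ => rfl
  · intro C hC
    obtain ⟨hC, hcard⟩ := mem_powersetCard.1 hC
    have hi := (subset_erase.1 hC).2
    simp [card_insert_of_notMem hi]
    omega
  · intro C hC
    obtain ⟨hC, hi⟩ := mem_filter.1 hC
    exact mem_powersetCard.2 ⟨erase_subset_erase i (subset_univ C), by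
      rw [card_erase_of_mem hi, (mem_powersetCard.1 hC).2]⟩
  · intro C hC
    exact erase_insert (subset_erase.1 (mem_powersetCard.1 hC).1).2
  · intro C hC
    exact insert_erase (mem_filter.1 hC).2

/-- The Exchange Value of agent `i` equals the average, over group sizes `m = 1,…,n−1`,
of the difference between the average value of size-`m` groups containing `i` and the
average value of size-`m` groups not containing `i`. -/
theorem exchangeValue_eq_group_average_difference
    {α : Type*} [Fintype α] [DecidableEq α]
    (hn : 2 ≤ Fintype.card α) (v : Finset α → ℝ) (hv : v ∅ = 0) (i : α) :
    ExchangeValue v i =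
      (1 / ((Fintype.card α : ℝ) - 1)) *
        ∑ m ∈ Finset.Icc 1 (Fintype.card α - 1),
          ((((Fintype.card α - 1).choose (m - 1) : ℝ))⁻¹ *
              ∑ C ∈ (Finset.univ.powersetCard m).filter (fun C => i ∈ C), v C
            - (((Fintype.card α - 1).choose m : ℝ))⁻¹ *
              ∑ C ∈ (Finset.univ.powersetCard m).filter (fun C => i ∉ C), v C) := by
  have hcard : #(univ.erase i) = Fintype.card α - 1 := card_erase_of_mem (mem_univ i)
  rw [ExchangeValue, sum_comm, Nat.cast_mul, mul_inv_rev, mul_assoc, Nat.cast_pred (by omega),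
    one_div, mul_sum]
  congr 1
  refine sum_congr rfl fun m hm => ?_
  obtain ⟨hm₁, hm₂⟩ := mem_Icc.1 hm
  rw [filter_notMem_powersetCard_univ, sum_filter_mem_powersetCard_univ i hm₁, sum_sub_distrib,
    mul_sub, ← hcard, inv_factorial_mul_sum_permsOf_take (by omega) v,
    inv_factorial_mul_sum_permsOf_take (by omega) fun C => v (insert i C)]
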